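/- For n ≥ 3 define the polynomial g_n = Σ_{σ ∈ S_n} x_{CP(σ)} y^{|CP(σ)|} in commuting variables x_1,...,x_n,y, where for a set S = {i_1,...,i_k} the monomial x_S denotes x_{i_1}x_{i_2}···x_{i_k} (with x_∅ = 1). Then g_3 = 4 + 2x_3y, and for all n ≥ 3: g_{n+1} = [2 + (n−1)x_{n+1}y]·g_n + 2x_{n+1}·Σ_{i=1}^{n} ∂g_n/∂x_i − 2x_{n+1}y²·∂g_n/∂y. -/

import Mathlib

/-- The permutation σ of `Fin n` viewed as a word on `[n] = {1,…,n}`: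
position `j` (0-indexed) carries the letter `σ(j)+1`; out-of-range positions give `0`. -/
def permToFun (n : ℕ) (σ : Equiv.Perm (Fin n)) : ℕ → ℕ :=
  fun j => if h : j < n then ((σ ⟨j, h⟩ : ℕ) + 1) else 0

/-- The circular peak set `CP(σ) = {σ(i) | σ(i-1) < σ(i) > σ(i+1)}` of a
permutation of `[n]`, as a `Finset ℕ` of values in `{1,…,n}`. -/
def circularPeakSet (n : ℕ) (σ : Equiv.Perm (Fin n)) : Finset ℕ :=
  ((Finset.Ioo 0 (n - 1)).filter (fun j =>
    permToFun n σ (j - 1) < permToFun n σ j ∧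
    permToFun n σ (j + 1) < permToFun n σ j)).image (permToFun n σ)

/-- `CPperms n S` is the set `CP_n(S)` of permutations of `[n]` with circular peak set `S`. -/
def CPperms (n : ℕ) (S : Finset ℕ) : Finset (Equiv.Perm (Fin n)) :=
  Finset.univ.filter (fun σ => circularPeakSet n σ = S)

/-- `cp n S = |CP_n(S)|`. -/
def cp (n : ℕ) (S : Finset ℕ) : ℕ := (CPperms n S).card

open MvPolynomial in
/-- The generating function `g_n = Σ_{σ ∈ S_n} x_{CP(σ)} y^{|CP(σ)|}`, in the
polynomial ring `ℤ[x_1, x_2, …, y]` where `x_i = X (some i)` and `y = X none`. -/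
noncomputable def gpoly (n : ℕ) : MvPolynomial (Option ℕ) ℤ :=
  ∑ σ : Equiv.Perm (Fin n),
    (∏ s ∈ circularPeakSet n σ, X (some s)) * X none ^ (circularPeakSet n σ).card

def insPerm (n : ℕ) (p : Fin (n+1)) (σ : Equiv.Perm (Fin n)) : Equiv.Perm (Fin (n+1)) :=
  (finSuccEquiv' p).trans ((Equiv.optionCongr σ).trans (finSuccEquiv' (Fin.last n)).symm)

theorem insPerm_at (n : ℕ) (p : Fin (n+1)) (σ : Equiv.Perm (Fin n)) :
    insPerm n p σ p = Fin.last n := by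
  simp [insPerm]

theorem insPerm_succAbove (n : ℕ) (p : Fin (n+1)) (σ : Equiv.Perm (Fin n)) (j : Fin n) :
    insPerm n p σ (p.succAbove j) = (σ j).castSucc := by
  simp [insPerm]

theorem insPerm_bij (n : ℕ) :
    Function.Bijective (fun q : Fin (n+1) × Equiv.Perm (Fin n) => insPerm n q.1 q.2) := by
  rw [Fintype.bijective_iff_injective_and_card]
  constructor
  · rintro ⟨p, σ⟩ ⟨q, τ⟩ h
    simp only at h
    have hpq : p = q := by
      apply (insPerm n q τ).injective
      rw [insPerm_at, ← h, insPerm_at]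
    subst hpq
    refine Prod.ext rfl ?_
    ext j
    have := insPerm_succAbove n p σ j
    rw [h, insPerm_succAbove] at this
    have := congrArg Fin.val this
    simpa using this.symm
  · simp [Fintype.card_perm, Nat.factorial_succ]

theorem ptf_lt (n : ℕ) (σ : Equiv.Perm (Fin n)) (j : ℕ) : permToFun n σ j < n + 1 := by
  unfold permToFun
  split_ifs <;> omega

theorem ptf_inj (n : ℕ) (σ : Equiv.Perm (Fin n)) (i j : ℕ) (hi : i < n) (hj : j < n)
    (h : permToFun n σ i = permToFun n σ j) : i = j := by
  simp only [permToFun, hi, hj, dif_pos] at h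
  have : σ ⟨i, hi⟩ = σ ⟨j, hj⟩ := Fin.ext (by omega)
  simpa using σ.injective this

theorem ptf_ins (n : ℕ) (p : Fin (n+1)) (σ : Equiv.Perm (Fin n)) (j : ℕ) :
    permToFun (n+1) (insPerm n p σ) j =
      if j < p then permToFun n σ j else if j = p then n + 1 else permToFun n σ (j - 1) := by
  have hp := p.2
  split_ifs with h1 h2
  · have hj : j < n := by omega
    have := insPerm_succAbove n p σ ⟨j, hj⟩
    rw [Fin.succAbove_of_castSucc_lt _ _ (by simpa [Fin.lt_def] using h1)] at this
    have h3 : j < n + 1 := by omega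
    have e : (⟨j, h3⟩ : Fin (n+1)) = Fin.castSucc ⟨j, hj⟩ := rfl
    simp only [permToFun, hj, h3, dif_pos, e, this, Fin.val_castSucc]
  · subst h2
    simp [permToFun, insPerm_at]; omega
  · by_cases h3 : j < n + 1
    · have hj : j - 1 < n := by omega
      have := insPerm_succAbove n p σ ⟨j - 1, hj⟩
      rw [Fin.succAbove_of_le_castSucc _ _ (by simp [Fin.le_def]; omega)] at this
      have e : (⟨j, h3⟩ : Fin (n+1)) = Fin.succ ⟨j - 1, hj⟩ := by
        apply Fin.ext; simp; omega
      simp only [permToFun, hj, h3, dif_pos, e, this, Fin.val_castSucc]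
    · have hj : ¬ (j - 1 < n) := by omega
      simp [permToFun, h3, hj]

theorem mem_cps (n : ℕ) (σ : Equiv.Perm (Fin n)) (s : ℕ) :
    s ∈ circularPeakSet n σ ↔ ∃ j, (0 < j ∧ j < n - 1) ∧
      (permToFun n σ (j - 1) < permToFun n σ j ∧ permToFun n σ (j + 1) < permToFun n σ j) ∧
      permToFun n σ j = s := by
  simp [circularPeakSet, and_assoc]

theorem ptf_mem (n : ℕ) (σ : Equiv.Perm (Fin n)) (j : ℕ) (hj : j < n) :
    permToFun n σ j ∈ circularPeakSet n σ ↔ (0 < j ∧ j < n - 1) ∧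
      (permToFun n σ (j - 1) < permToFun n σ j ∧ permToFun n σ (j + 1) < permToFun n σ j) := by
  rw [mem_cps]
  constructor
  · rintro ⟨i, hi, hi2, he⟩
    have := ptf_inj n σ i j (by omega) hj he
    subst this
    exact ⟨hi, hi2⟩
  · rintro ⟨h1, h2⟩
    exact ⟨j, h1, h2, rfl⟩

theorem cps_ins_end (n : ℕ) (p : Fin (n+1)) (σ : Equiv.Perm (Fin n))
    (hp : (p : ℕ) = 0 ∨ (p : ℕ) = n) :
    circularPeakSet (n+1) (insPerm n p σ) = circularPeakSet n σ := by
  have hw := ptf_lt n σ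
  ext s
  simp only [mem_cps, ptf_ins]
  rcases hp with hp | hp <;> simp only [hp]
  · constructor
    · rintro ⟨j, hj, hpk, rfl⟩
      have := hw j
      have := hw (j-1)
      obtain ⟨i, rfl⟩ : ∃ i, j = i + 1 := ⟨j - 1, by omega⟩
      rcases i with _ | i
      · simp at hpk; grind
      · refine ⟨i + 1, by omega, ?_, ?_⟩ <;> grind
    · rintro ⟨j, hj, hpk, rfl⟩
      refine ⟨j + 1, by omega, ?_, ?_⟩ <;> grind
  · constructor
    · rintro ⟨j, hj, hpk, rfl⟩
      have := hw j
      refine ⟨j, ?_, ?_, ?_⟩ <;> grind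
    · rintro ⟨j, hj, hpk, rfl⟩
      refine ⟨j, by omega, ?_, ?_⟩ <;> grind

theorem cps_ins_mid (n : ℕ) (p : Fin (n+1)) (σ : Equiv.Perm (Fin n))
    (hp : 0 < (p : ℕ)) (hp2 : (p : ℕ) < n) :
    circularPeakSet (n+1) (insPerm n p σ) = insert (n+1)
      (((circularPeakSet n σ).erase (permToFun n σ (p - 1))).erase (permToFun n σ p)) := by
  have hw := ptf_lt n σ
  have hinj := ptf_inj n σ
  ext s
  simp only [mem_cps, ptf_ins, Finset.mem_insert, Finset.mem_erase]
  generalize (p : ℕ) = p at *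
  constructor
  · rintro ⟨j, hj, hpk, rfl⟩
    by_cases hjp : j = p
    · left; simp [hjp]
    · right
      have := hw j
      have := hw (j-1)
      by_cases hlt : j < p
      · have hj1 : j + 1 ≠ p := by intro h; grind
        refine ⟨?_, ?_, j, ?_, ?_, ?_⟩
        · intro h; have := hinj j p (by omega) hp2 (by grind); omega
        · intro h; have := hinj j (p-1) (by omega) (by omega) (by grind); omega
        all_goals grind
      · have hj1 : j ≠ p + 1 := by intro h; subst h; grind
        refine ⟨?_, ?_, j - 1, ?_, ?_, ?_⟩
        · intro h; have := hinj (j-1) p (by omega) hp2 (by grind); omega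
        · intro h; have := hinj (j-1) (p-1) (by omega) (by omega) (by grind); omega
        all_goals grind
  · rintro (rfl | ⟨h1, h2, j, hj, hpk, rfl⟩)
    · refine ⟨p, by omega, ?_, by simp⟩
      have := hw p
      have := hw (p-1)
      grind
    · have hjp : j ≠ p := by rintro rfl; exact h1 rfl
      have hjp' : j ≠ p - 1 := by rintro rfl; exact h2 rfl
      by_cases hlt : j < p
      · refine ⟨j, by omega, ?_, ?_⟩ <;> grind
      · refine ⟨j + 1, by omega, ?_, ?_⟩ <;> grind

open MvPolynomial

noncomputable def MM (S : Finset ℕ) : MvPolynomial (Option ℕ) ℤ := ∏ s ∈ S, (X (some s) * X none)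

theorem gpoly_eq (n : ℕ) : gpoly n = ∑ σ : Equiv.Perm (Fin n), MM (circularPeakSet n σ) := by
  simp [gpoly, MM, Finset.prod_mul_distrib]

theorem MM_insert (S : Finset ℕ) (a : ℕ) (h : a ∉ S) :
    MM (insert a S) = X (some a) * X none * MM S := by
  simp [MM, h]

theorem pderiv_some_MM (S : Finset ℕ) (i : ℕ) :
    pderiv (some i) (MM S) = if i ∈ S then X none * MM (S.erase i) else 0 := by
  have key : ∀ S : Finset ℕ, i ∉ S → pderiv (some i) (MM S) = 0 := by
    intro S
    induction S using Finset.induction_on with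
    | empty => simp [MM]
    | insert a S ha ih =>
      intro h
      simp only [Finset.mem_insert, not_or] at h
      rw [MM_insert _ _ ha]
      simp [ih h.2, Ne.symm h.1, Derivation.leibniz]
  split_ifs with h
  · conv_lhs => rw [← Finset.insert_erase h]
    rw [MM_insert _ _ (by simp)]
    simp [key _ (Finset.notMem_erase i S), Derivation.leibniz]
    ring
  · exact key S h

theorem pderiv_none_MM (S : Finset ℕ) :
    X none * pderiv none (MM S) = (S.card : MvPolynomial (Option ℕ) ℤ) * MM S := by
  induction S using Finset.induction_on with
  | empty => simp [MM]
  | insert a S ha ih =>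
    rw [MM_insert _ _ ha, Finset.card_insert_of_notMem ha]
    simp [Derivation.leibniz]
    linear_combination (X (some a) * X none) * ih

noncomputable def DD (S : Finset ℕ) (s : ℕ) : MvPolynomial (Option ℕ) ℤ :=
  if s ∈ S then MM (S.erase s) - MM S else 0

theorem MM_erase2 (S : Finset ℕ) (a b : ℕ) (h : ¬ (a ∈ S ∧ b ∈ S)) :
    MM ((S.erase a).erase b) = MM S + DD S a + DD S b := by
  unfold DD
  by_cases ha : a ∈ S
  · have hb : b ∉ S := fun hb => h ⟨ha, hb⟩
    rw [Finset.erase_eq_of_notMem (s := S.erase a) (by simp [hb])]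
    simp [ha, hb]
  · rw [Finset.erase_eq_of_notMem ha]
    by_cases hb : b ∈ S
    · simp [ha, hb]
    · rw [Finset.erase_eq_of_notMem hb]; simp [ha, hb]

theorem sum_DD (n : ℕ) (σ : Equiv.Perm (Fin n)) (f : ℕ → MvPolynomial (Option ℕ) ℤ) :
    ∑ j ∈ Finset.range n, f (permToFun n σ j) = ∑ i ∈ Finset.Icc 1 n, f i := by
  rw [Finset.sum_range]
  have : ∀ j : Fin n, f (permToFun n σ j) = (fun j : Fin n => f ((j : ℕ) + 1)) (σ j) := by
    intro j; simp [permToFun]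
  simp_rw [this]
  rw [Equiv.sum_comp σ (fun j : Fin n => f ((j : ℕ) + 1)), ← Finset.sum_range (fun j => f (j+1)),
    Finset.range_eq_Ico, Finset.sum_Ico_add' f 0 n 1]
  rfl

theorem cps_subset (n : ℕ) (σ : Equiv.Perm (Fin n)) : circularPeakSet n σ ⊆ Finset.Icc 1 n := by
  intro s hs
  rw [mem_cps] at hs
  obtain ⟨j, hj, hpk, rfl⟩ := hs
  have := ptf_lt n σ j
  simp; omega

theorem insPerm_inner (m : ℕ) (σ : Equiv.Perm (Fin (m+1))) (S : Finset ℕ)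
    (hS : S = circularPeakSet (m+1) σ) :
    ∑ p : Fin (m+2), MM (circularPeakSet (m+2) (insPerm (m+1) p σ)) =
      2 * MM S + X (some (m+2)) * X none *
        ((m : MvPolynomial (Option ℕ) ℤ) * MM S + 2 * ∑ i ∈ Finset.Icc 1 (m+1), DD S i) := by
  set w := permToFun (m+1) σ with hw
  have h1 : ∀ p : Fin (m+2), MM (circularPeakSet (m+2) (insPerm (m+1) p σ)) =
      (fun p : ℕ => if p = 0 ∨ p = m+1 then MM S else X (some (m+2)) * X none *
        (MM S + DD S (w (p-1)) + DD S (w p))) p := by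
    intro p
    have hp := p.2
    simp only
    split_ifs with h
    · rw [cps_ins_end _ _ _ h, hS]
    · push Not at h
      rw [cps_ins_mid _ _ _ (by omega) (by omega), MM_insert, MM_erase2, hS]
      · rw [ptf_mem _ _ _ (by omega), ptf_mem _ _ _ (by omega)]
        have e : (p : ℕ) - 1 + 1 = p := by omega
        rw [e]
        rintro ⟨a, b⟩
        omega
      · intro hm
        have := cps_subset _ _ (Finset.mem_of_mem_erase (Finset.mem_of_mem_erase hm))
        simp at this
  simp_rw [h1]
  rw [← Finset.sum_range (fun p : ℕ => if p = 0 ∨ p = m+1 then MM S else X (some (m+2)) * X none *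
        (MM S + DD S (w (p-1)) + DD S (w p))), Finset.sum_range_succ, Finset.sum_range_succ']
  have h2 : ∀ k ∈ Finset.range m, (if k + 1 = 0 ∨ k + 1 = m+1 then MM S else
      X (some (m+2)) * X none * (MM S + DD S (w (k+1-1)) + DD S (w (k+1)))) =
      X (some (m+2)) * X none * (MM S + DD S (w k) + DD S (w (k+1))) := by
    intro k hk
    rw [Finset.mem_range] at hk
    rw [if_neg (by omega)]; simp
  rw [Finset.sum_congr rfl h2, ← Finset.mul_sum, Finset.sum_add_distrib, Finset.sum_add_distrib]
  have h0 : DD S (w 0) = 0 := by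
    unfold DD; rw [if_neg]; rw [hS, hw, ptf_mem _ _ _ (by omega)]; omega
  have hm : DD S (w m) = 0 := by
    unfold DD; rw [if_neg]; rw [hS, hw, ptf_mem _ _ _ (by omega)]; omega
  have s := sum_DD (m+1) σ (DD S)
  have s' := s
  rw [Finset.sum_range_succ, ← hw, hm] at s
  rw [Finset.sum_range_succ', ← hw, h0] at s'
  simp
  linear_combination (X (some (m+2)) * X none) * (s + s')

theorem rec_gen (m : ℕ) :
      gpoly (m + 2) =
        (2 + (m : MvPolynomial (Option ℕ) ℤ) * X (some (m + 2)) * X none) * gpoly (m+1) +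
        2 * X (some (m + 2)) * ∑ i ∈ Finset.Icc 1 (m+1), pderiv (some i) (gpoly (m+1)) -
        2 * X (some (m + 2)) * X none ^ 2 * pderiv none (gpoly (m+1)) := by
  rw [gpoly_eq (m+2), ← (insPerm_bij (m+1)).sum_comp, Fintype.sum_prod_type_right, gpoly_eq (m+1)]
  simp_rw [map_sum]
  rw [Finset.sum_comm (s := Finset.Icc 1 (m+1)), Finset.mul_sum, Finset.mul_sum, Finset.mul_sum, ← Finset.sum_add_distrib,
    ← Finset.sum_sub_distrib]
  refine Finset.sum_congr rfl fun σ _ => ?_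
  rw [insPerm_inner m σ _ rfl]
  have hsub := cps_subset _ σ
  generalize circularPeakSet (m+1) σ = S at *
  have hn := pderiv_none_MM S
  have e1 : ∑ i ∈ Finset.Icc 1 (m+1), pderiv (some i) (MM S) =
      X none * ∑ i ∈ S, MM (S.erase i) := by
    simp_rw [pderiv_some_MM]
    rw [Finset.sum_ite_mem, Finset.inter_eq_right.2 hsub, Finset.mul_sum]
  have e2 : ∑ i ∈ Finset.Icc 1 (m+1), DD S i = ∑ i ∈ S, MM (S.erase i) - S.card * MM S := by
    unfold DD
    rw [Finset.sum_ite_mem, Finset.inter_eq_right.2 hsub, Finset.sum_sub_distrib]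
    simp
  rw [e1, e2]
  linear_combination (2 * X (some (m+2)) * X none) * hn

theorem gpoly_two : gpoly 2 = 2 := by
  rw [gpoly_eq]
  have : ∀ σ : Equiv.Perm (Fin 2), MM (circularPeakSet 2 σ) = 1 := by
    intro σ
    have : circularPeakSet 2 σ = ∅ := by
      ext s; rw [mem_cps]; simp
    rw [this]; simp [MM]
  simp [this, Fintype.card_perm]

open MvPolynomial in
/-- Corollary 3.1: `g_3 = 4 + 2 x_3 y`, and for `n ≥ 3`,
`g_{n+1} = [2 + (n-1) x_{n+1} y] g_n + 2 x_{n+1} Σ_{i=1}^n ∂g_n/∂x_i - 2 x_{n+1} y² ∂g_n/∂y`. -/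
theorem gpoly_recurrence :
    gpoly 3 = 4 + 2 * X (some 3) * X none ∧
    ∀ n, 3 ≤ n →
      gpoly (n + 1) =
        (2 + C ((n : ℤ) - 1) * X (some (n + 1)) * X none) * gpoly n +
        2 * X (some (n + 1)) * ∑ i ∈ Finset.Icc 1 n, pderiv (some i) (gpoly n) -
        2 * X (some (n + 1)) * X none ^ 2 * pderiv none (gpoly n) := by
  refine ⟨?_, ?_⟩
  · have := rec_gen 1
    simp only [Nat.reduceAdd, gpoly_two] at this
    rw [this]
    have h : ∀ i : Option ℕ, pderiv i (2 : MvPolynomial (Option ℕ) ℤ) = 0 := by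
      intro i
      exact (pderiv i).map_natCast 2
    simp [h]
    ring
  · intro n hn
    obtain ⟨m, rfl⟩ : ∃ m, n = m + 1 := ⟨n - 1, by omega⟩
    have e : (C (((m + 1 : ℕ) : ℤ) - 1) : MvPolynomial (Option ℕ) ℤ) = m := by
      simp
    rw [e]
    exact rec_gen m
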